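/- Let S and A be finite nonempty types, T : S × A → PMF S a Markov kernel (the shared dynamics), and μπ, μE probability mass functions on S × A. Let ρπ, ρE be the induced joint distributions on S × A × S, ρ(s,a,s') = μ(s,a)·T(s,a)(s'). Then the Jensen–Shannon divergence between the joint distributions equals the Jensen–Shannon divergence between the state-action marginals: D_JS(ρπ ‖ ρE) = D_JS(μπ ‖ μE). -/

import Mathlib

open scoped BigOperators

/-- Kullback–Leibler divergence: `D_KL(p ‖ q) = Σ_x p(x)·log(p(x)/q(x))`,
with terms where `p x = 0` equal to `0`. -/
noncomputable def klDiv {X : Type*} [Fintype X] (p q : X → ℝ) : ℝ :=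
  ∑ x, p x * Real.log (p x / q x)

/-- Jensen–Shannon divergence:
`D_JS(p ‖ q) = (1/2)·D_KL(p ‖ m) + (1/2)·D_KL(q ‖ m)` with `m = (p + q)/2`. -/
noncomputable def jsDiv {X : Type*} [Fintype X] (p q : X → ℝ) : ℝ :=
  (1 / 2) * klDiv p (fun x => (p x + q x) / 2) +
    (1 / 2) * klDiv q (fun x => (p x + q x) / 2)

/-- The real-valued mass function of a `PMF`. -/
noncomputable def pmfReal {X : Type*} (μ : PMF X) : X → ℝ := fun x => (μ x).toReal

/-- The joint distribution on `S × A × S` induced by a state-action occupancy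
measure `μ` and a Markov kernel `T`: `ρ(s,a,s') = μ(s,a) · T(s,a)(s')`. -/
noncomputable def joint {S A : Type*} (T : S × A → PMF S) (μ : PMF (S × A)) :
    S × A × S → ℝ :=
  fun x => (μ (x.1, x.2.1)).toReal * ((T (x.1, x.2.1)) x.2.2).toReal

theorem PMF.sum_toReal_eq_one {X : Type*} [Fintype X] (μ : PMF X) :
    ∑ x, (μ x).toReal = 1 := by
  rw [← ENNReal.toReal_sum fun x _ => μ.apply_ne_top x, ← tsum_fintype (L := .unconditional X),
    μ.tsum_coe, ENNReal.toReal_one]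

/-- KL divergence is unchanged when both arguments are extended by a common kernel. -/
theorem klDiv_mul_kernel {S A : Type*} [Fintype S] [Fintype A]
    (T : S × A → PMF S) (p q : S × A → ℝ) :
    klDiv (fun x : S × A × S => p (x.1, x.2.1) * (T (x.1, x.2.1) x.2.2).toReal)
      (fun x => q (x.1, x.2.1) * (T (x.1, x.2.1) x.2.2).toReal) = klDiv p q := by
  simp only [klDiv, Fintype.sum_prod_type]
  refine Finset.sum_congr rfl fun s _ => Finset.sum_congr rfl fun a _ => ?_
  rw [← mul_one (p (s, a) * _), ← (T (s, a)).sum_toReal_eq_one, Finset.mul_sum]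
  refine Finset.sum_congr rfl fun t _ => ?_
  by_cases ht : (T (s, a) t).toReal = 0
  · simp [ht]
  · rw [mul_div_mul_right _ _ ht]
    ring

/-- The Jensen–Shannon divergence between the induced joint distributions
equals the Jensen–Shannon divergence between the state-action marginals. -/
theorem js_joint_eq_js_stateAction {S A : Type*}
    [Fintype S] [Fintype A] [Nonempty S] [Nonempty A]
    (T : S × A → PMF S) (μπ μE : PMF (S × A)) :
    jsDiv (joint T μπ) (joint T μE) = jsDiv (pmfReal μπ) (pmfReal μE) := by
  have hmid : (fun x => (joint T μπ x + joint T μE x) / 2) = fun x : S × A × S =>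
      (pmfReal μπ (x.1, x.2.1) + pmfReal μE (x.1, x.2.1)) / 2 *
        (T (x.1, x.2.1) x.2.2).toReal := by
    funext x
    simp only [joint, pmfReal]
    ring
  have hkl (μ : PMF (S × A)) :
      klDiv (joint T μ) (fun x => (joint T μπ x + joint T μE x) / 2) =
        klDiv (pmfReal μ) (fun x => (pmfReal μπ x + pmfReal μE x) / 2) := by
    rw [hmid]
    exact klDiv_mul_kernel T (pmfReal μ) (fun x => (pmfReal μπ x + pmfReal μE x) / 2)
  rw [jsDiv, jsDiv, hkl, hkl]
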